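/- arXiv:1807.08579 — 3 statements merged into one kernel-verified Lean document; each statement's English description precedes it below -/
import Mathlib

section
/- Let n be a positive integer, δ a positive rational, and for 1 ≤ i ≤ n let τ_i = (δ, i·δ, p_i) with p_i a positive rational (so e_i = δ and d_i = i·δ, hence d_n = n·δ). Suppose f(τ,t) ≤ t for all t > 0, and suppose τ is aligned, i.e., there is a permutation π of {1,…,n} with d_{π(i)} + p_{π(i)} = n·δ + i·δ for all i. Then dbf*(τ, n·δ) ≤ (14/9)·n·δ. -/
open Finset

/-- Demand bound function of a task `(e, d, p)` at time `t`. -/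
noncomputable def dbf (e d p t : ℝ) : ℝ :=
  if t < d then 0 else ((⌊(t - d) / p⌋ : ℝ) + 1) * e

/-- Approximate demand bound function of a task `(e, d, p)` at time `t`. -/
noncomputable def dbfStar (e d p t : ℝ) : ℝ :=
  if t < d then 0 else ((t - d) / p + 1) * e

/-- Modified demand function `f` of a task `(e, d, p)` at time `t`. -/
noncomputable def fmod (e d p t : ℝ) : ℝ :=
  if t < d + p then dbf e d p t else 2 * e

/-- A separable upper bound for `a / (a + r ^ 2)`; the difference is a perfect square. -/
lemma div_add_sq_le (k : ℝ) {a r : ℝ} (ha : 0 ≤ a) (hr : 0 < r) :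
    a / (a + r ^ 2) ≤ k ^ 2 * a + (1 - k * r) ^ 2 := by
  rw [div_le_iff₀ (by positivity)]
  nlinarith [sq_nonneg (k * (a + r ^ 2) - r)]

lemma two_thirds_mul_sqrt_le_sum_sqrt (n : ℕ) :
    2 / 3 * ((n : ℝ) * √(n : ℝ)) ≤ ∑ i ∈ Icc 1 n, √(i : ℝ) := by
  induction n with
  | zero => simp
  | succ n ih =>
    rw [sum_Icc_succ_top (by omega)]
    have hr : √(n : ℝ) ^ 2 = n := Real.sq_sqrt (by positivity)
    have hs : √((n + 1 : ℕ) : ℝ) ^ 2 = n + 1 := by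
      rw [Real.sq_sqrt (by positivity)]; push_cast; rfl
    have hr0 := Real.sqrt_nonneg (n : ℝ)
    have hs0 := Real.sqrt_nonneg ((n + 1 : ℕ) : ℝ)
    push_cast at *
    generalize √(n : ℝ) = r at *
    generalize √((n : ℝ) + 1) = s at *
    have key : 0 ≤ (s - r) ^ 2 * (s + 2 * r) := by positivity
    have hsr : s * (s ^ 2 - r ^ 2) = s := by rw [hs, hr]; ring
    rw [← hr] at ih ⊢
    rw [← hr] at hs
    rw [← hs]
    nlinarith

lemma sum_Icc_one_comp_perm {M : Type*} [AddCommMonoid M] (n : ℕ) (π : Equiv.Perm ℕ)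
    (hπ : ∀ i ∈ Icc 1 n, π i ∈ Icc 1 n) (g : ℕ → M) :
    ∑ i ∈ Icc 1 n, g (π i) = ∑ i ∈ Icc 1 n, g i := by
  have himage : (Icc 1 n).image π = Icc 1 n :=
    eq_of_subset_of_card_le (image_subset_iff.mpr hπ)
      (card_image_of_injective _ π.injective).ge
  conv_rhs => rw [← himage, sum_image π.injective.injOn]

lemma dbfStar_le_of_aligned {n i j δ p : ℝ} (hi : 0 < i) (hj : j ≤ n) (hn : 0 < n) (hδ : 0 < δ)
    (h : j * δ + p = n * δ + i * δ) :
    dbfStar δ (j * δ) p (n * δ) ≤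
      (4 / (9 * n) * (n - j) + 4 / (9 * n) * i + 2 - 4 / (3 * √n) * √i) * δ := by
  have hnj : 0 ≤ n - j := sub_nonneg.mpr hj
  have hp : p = (n - j + √i ^ 2) * δ := by rw [Real.sq_sqrt hi.le]; linarith
  rw [dbfStar, if_neg (not_lt.mpr (by gcongr))]
  gcongr
  rw [hp, ← sub_mul, mul_div_mul_right _ _ hδ.ne']
  have hk : (2 / (3 * √n)) ^ 2 = 4 / (9 * n) := by
    rw [div_pow, mul_pow, Real.sq_sqrt hn.le]; norm_num
  have hbound := div_add_sq_le (2 / (3 * √n)) hnj (Real.sqrt_pos.mpr hi)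
  have hsq : (1 - 2 / (3 * √n) * √i) ^ 2 = 1 - 4 / (3 * √n) * √i + 4 / (9 * n) * i := by
    rw [sub_sq, mul_pow, hk, Real.sq_sqrt hi.le]; ring
  rw [hk, hsq] at hbound
  linarith

/-- For tasks `τ_i = (δ, i·δ, p_i)` (`1 ≤ i ≤ n`, positive rational parameters)
with `f(τ,t) ≤ t` for all `t > 0` and `τ` aligned, we have `dbf*(τ, n·δ) ≤ (14/9)·n·δ`. -/
theorem stmt4 (n : ℕ) (hn : 0 < n) (δ : ℚ) (hδ : 0 < δ)
    (p : ℕ → ℚ) (hp : ∀ i ∈ Finset.Icc 1 n, 0 < p i)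
    (hf : ∀ t : ℝ, 0 < t →
      ∑ i ∈ Finset.Icc 1 n, fmod (δ : ℝ) ((i : ℝ) * (δ : ℝ)) ((p i : ℝ)) t ≤ t)
    (π : Equiv.Perm ℕ) (hπ : ∀ i ∈ Finset.Icc 1 n, π i ∈ Finset.Icc 1 n)
    (halign : ∀ i ∈ Finset.Icc 1 n, (π i : ℚ) * δ + p (π i) = (n : ℚ) * δ + (i : ℚ) * δ) :
    ∑ i ∈ Finset.Icc 1 n, dbfStar (δ : ℝ) ((i : ℝ) * (δ : ℝ)) ((p i : ℝ)) ((n : ℝ) * (δ : ℝ))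
      ≤ 14 / 9 * ((n : ℝ) * (δ : ℝ)) := by
  have hn' : (0 : ℝ) < n := by exact_mod_cast hn
  have hδ' : (0 : ℝ) < δ := by exact_mod_cast hδ
  rw [← sum_Icc_one_comp_perm n π hπ]
  have hterm : ∀ i ∈ Icc 1 n,
      dbfStar (δ : ℝ) ((π i : ℝ) * δ) (p (π i) : ℝ) (n * δ) ≤
        (4 / (9 * n) * ((n : ℝ) - (π i : ℝ)) + 4 / (9 * n) * i + 2 - 4 / (3 * √n) * √i) * δ := by
    intro i hi
    refine dbfStar_le_of_aligned ?_ ?_ hn' hδ' ?_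
    · exact_mod_cast (mem_Icc.mp hi).1
    · exact_mod_cast (mem_Icc.mp (hπ i hi)).2
    · exact_mod_cast congrArg (Rat.cast : ℚ → ℝ) (halign i hi)
  refine (sum_le_sum hterm).trans ?_
  have hsum := sum_Icc_one_comp_perm n π hπ (fun i => (i : ℝ))
  simp only [← sum_mul, sum_sub_distrib, sum_add_distrib, ← mul_sum, hsum, sum_const,
    Nat.card_Icc, Nat.add_sub_cancel, nsmul_eq_mul]
  rw [← mul_assoc]
  gcongr
  have hsqrt : 8 / 9 * (n : ℝ) ≤ 4 / (3 * √n) * ∑ i ∈ Icc 1 n, √(i : ℝ) :=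
    calc 8 / 9 * (n : ℝ) = 4 / (3 * √n) * (2 / 3 * (n * √n)) := by field_simp; norm_num
      _ ≤ _ := by gcongr; exact two_thirds_mul_sqrt_le_sum_sqrt n
  have hcancel : 4 / (9 * (n : ℝ)) * (n * n) = 4 / 9 * n := by field_simp
  linarith
end

section
/- Let τ = {τ_i=(e_i,d_i,p_i): 1 ≤ i ≤ n} be constrained-deadline tasks with positive rational parameters satisfying: d_1 ≤ … ≤ d_n; dbf(τ,t) ≤ t for all t > 0; d_i + p_i > d_n for all 1 ≤ i ≤ n−1. Then there exists a set τ' = {τ'_i=(e'_i,d'_i,p'_i): 1 ≤ i ≤ n} of constrained-deadline tasks with positive rational parameters such that: dbf(τ',t) ≤ t for all t > 0; d'_i + p'_i > d'_n for all 1 ≤ i ≤ n−1; d'_i = e'_i + d'_{i−1} for all 1 ≤ i ≤ n (with d'_0 := 0); and dbf*(τ', d'_n)/d'_n ≥ dbf*(τ, d_n)/d_n. -/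
open Finset

/-- Before the second absolute deadline, a task demands at most one job. -/
lemma dbf_of_lt_add {e d p t : ℝ} (hp : 0 < p) (ht : t < d + p) :
    dbf e d p t = if t < d then 0 else e := by
  unfold dbf
  split_ifs with h
  · rfl
  · have hfloor : ⌊(t - d) / p⌋ = 0 := by
      rw [Int.floor_eq_zero_iff]
      exact ⟨div_nonneg (by linarith) hp.le, (div_lt_one hp).2 (by linarith)⟩
    simp [hfloor]

lemma le_dbf {e d p t : ℝ} (he : 0 ≤ e) (hp : 0 < p) (ht : d ≤ t) : e ≤ dbf e d p t := by
  have hfloor : (0 : ℝ) ≤ ⌊(t - d) / p⌋ := by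
    exact_mod_cast Int.floor_nonneg.2 (div_nonneg (by linarith) hp.le)
  rw [dbf, if_neg (by linarith)]
  nlinarith

lemma dbf_nonneg {e d p t : ℝ} (he : 0 ≤ e) (hp : 0 < p) : 0 ≤ dbf e d p t := by
  by_cases h : t < d
  · simp [dbf, h]
  · exact he.trans (le_dbf he hp (not_lt.1 h))

/-- Shortening the relative deadline while keeping the second absolute deadline does not
increase the demand from the original deadline on. -/
lemma dbf_shorten_deadline_le {e d p s t : ℝ} (he : 0 ≤ e) (hp : 0 < p) (hs : s ≤ d)
    (ht : d ≤ t) : dbf e s (p + d - s) t ≤ dbf e d p t := by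
  have hp' : 0 < p + d - s := by linarith
  rcases lt_or_ge t (d + p) with h | h
  · rw [dbf_of_lt_add hp' (by linarith), dbf_of_lt_add hp h, if_neg (by linarith),
      if_neg (by linarith)]
  · rw [dbf, dbf, if_neg (by linarith), if_neg (by linarith)]
    have hdiv : (t - s) / (p + d - s) ≤ (t - d) / p := by
      rw [div_le_div_iff₀ hp' hp]
      nlinarith [mul_nonneg (sub_nonneg.2 hs) (show 0 ≤ t - d - p by linarith)]
    have hfloor : (⌊(t - s) / (p + d - s)⌋ : ℝ) ≤ ⌊(t - d) / p⌋ := by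
      exact_mod_cast Int.floor_le_floor hdiv
    gcongr

/-- Shortening the relative deadline `d` to `s` and the horizon `D` to `S`, while keeping the
second absolute deadline, does not decrease the normalized approximate demand. -/
lemma dbfStar_div_le_shorten {e d p s D S : ℝ} (he : 0 ≤ e) (hp : 0 < p) (hdp : d ≤ p)
    (hsd : s ≤ d) (hdD : d ≤ D) (hD : D ≤ d + p) (hsS : s ≤ S) (hS : 0 < S) (hSD : S ≤ D) :
    dbfStar e d p D / D ≤ dbfStar e s (p + d - s) S / S := by
  have hp' : 0 < p + d - s := by linarith
  rw [dbfStar, dbfStar, if_neg (by linarith), if_neg (by linarith),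
    div_le_div_iff₀ (by linarith) hS]
  have hdiv : (D - d) / p ≤ (D - s) / (p + d - s) := by
    rw [div_le_div_iff₀ hp hp']
    nlinarith [mul_nonneg (sub_nonneg.2 hsd) (show 0 ≤ d + p - D by linarith)]
  have hratio : s / (p + d - s) ≤ 1 := (div_le_one hp').2 (by linarith)
  have hslope : ((D - s) / (p + d - s) + 1) * S ≤ ((S - s) / (p + d - s) + 1) * D := by
    have hdiff : ((S - s) / (p + d - s) + 1) * D - ((D - s) / (p + d - s) + 1) * S
        = (D - S) * (1 - s / (p + d - s)) := by
      field_simp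
      ring
    nlinarith [mul_nonneg (sub_nonneg.2 hSD) (sub_nonneg.2 hratio)]
  calc ((D - d) / p + 1) * e * S = e * (((D - d) / p + 1) * S) := by ring
    _ ≤ e * (((D - s) / (p + d - s) + 1) * S) := by gcongr
    _ ≤ e * (((S - s) / (p + d - s) + 1) * D) := by gcongr
    _ = ((S - s) / (p + d - s) + 1) * e * D := by ring

/-- If every job's deadline is the total execution time up to that job, then the jobs with
deadline at most `t` have total execution time at most `t`. -/
lemma sum_ite_cumulative_le {e s : ℕ → ℝ} {t : ℝ} (ht : 0 ≤ t) (hs0 : s 0 = 0) (n : ℕ)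
    (he : ∀ i ∈ Icc 1 n, 0 ≤ e i) (hs : ∀ i ∈ Icc 1 n, s i = e i + s (i - 1)) :
    ∑ i ∈ Icc 1 n, (if t < s i then 0 else e i) ≤ min t (s n) := by
  induction n with
  | zero => simp [hs0, ht]
  | succ m ih =>
    have hsub : ∀ i ∈ Icc 1 m, i ∈ Icc 1 (m + 1) := fun i hi ↦ by
      simp only [mem_Icc] at hi ⊢
      lia
    have hmem : m + 1 ∈ Icc 1 (m + 1) := by simp
    have hm := ih (fun i hi ↦ he i (hsub i hi)) fun i hi ↦ hs i (hsub i hi)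
    have hsucc : s (m + 1) = e (m + 1) + s m := hs _ hmem
    have hem := he _ hmem
    rw [le_min_iff] at hm
    rw [sum_Icc_succ_top (by lia), le_min_iff]
    split_ifs with h <;> constructor <;> linarith

/-- Given a feasible set of constrained-deadline tasks with positive rational
parameters (sorted deadlines, `dbf(τ,t) ≤ t`, `d_i + p_i > d_n` for `i ≤ n−1`), there is a
task set `τ'` of the same kind additionally satisfying `d'_i = e'_i + d'_{i−1}` (with
`d'_0 := 0`) and `dbf*(τ', d'_n)/d'_n ≥ dbf*(τ, d_n)/d_n`. -/
theorem stmt8 (n : ℕ) (hn : 0 < n) (e d p : ℕ → ℚ)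
    (hpos : ∀ i ∈ Finset.Icc 1 n, 0 < e i ∧ 0 < d i ∧ 0 < p i)
    (hcd : ∀ i ∈ Finset.Icc 1 n, d i ≤ p i)
    (hmono : ∀ i ∈ Finset.Icc 1 n, ∀ j ∈ Finset.Icc 1 n, i ≤ j → d i ≤ d j)
    (hdbf : ∀ t : ℝ, 0 < t →
      ∑ i ∈ Finset.Icc 1 n, dbf ((e i : ℝ)) ((d i : ℝ)) ((p i : ℝ)) t ≤ t)
    (hdp : ∀ i ∈ Finset.Icc 1 (n - 1), d i + p i > d n) :
    ∃ e' d' p' : ℕ → ℚ, d' 0 = 0 ∧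
      (∀ i ∈ Finset.Icc 1 n, 0 < e' i ∧ 0 < d' i ∧ 0 < p' i) ∧
      (∀ i ∈ Finset.Icc 1 n, d' i ≤ p' i) ∧
      (∀ t : ℝ, 0 < t →
        ∑ i ∈ Finset.Icc 1 n, dbf ((e' i : ℝ)) ((d' i : ℝ)) ((p' i : ℝ)) t ≤ t) ∧
      (∀ i ∈ Finset.Icc 1 (n - 1), d' i + p' i > d' n) ∧
      (∀ i ∈ Finset.Icc 1 n, d' i = e' i + d' (i - 1)) ∧
      (∑ i ∈ Finset.Icc 1 n, dbfStar ((e' i : ℝ)) ((d' i : ℝ)) ((p' i : ℝ)) ((d' n : ℝ))) /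
          (d' n : ℝ) ≥
        (∑ i ∈ Finset.Icc 1 n, dbfStar ((e i : ℝ)) ((d i : ℝ)) ((p i : ℝ)) ((d n : ℝ))) /
          (d n : ℝ) := by
  set s : ℕ → ℚ := fun i ↦ ∑ j ∈ Icc 1 i, e j with hs_def
  have hs0 : s 0 = 0 := by simp [hs_def]
  have hs : ∀ i ∈ Icc 1 n, s i = e i + s (i - 1) := by
    intro i hi
    obtain ⟨k, rfl⟩ : ∃ k, i = k + 1 := ⟨i - 1, by have := (mem_Icc.1 hi).1; lia⟩
    simp only [hs_def, Nat.add_sub_cancel]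
    rw [sum_Icc_succ_top (by lia), add_comm]
  have hn_mem : n ∈ Icc 1 n := by simp; lia
  have hs_mono : ∀ i ∈ Icc 1 n, s i ≤ s n := fun i hi ↦
    sum_le_sum_of_subset_of_nonneg (Icc_subset_Icc_right (mem_Icc.1 hi).2)
      fun j hj _ ↦ (hpos j hj).1.le
  have hs_pos : ∀ i ∈ Icc 1 n, 0 < s i := by
    intro i hi
    rw [mem_Icc] at hi
    refine sum_pos (fun j hj ↦ (hpos j ?_).1) ⟨1, by simp; lia⟩
    simp only [mem_Icc] at hj ⊢
    lia
  have hsd : ∀ i ∈ Icc 1 n, s i ≤ d i := by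
    intro i hi
    have hle : (s i : ℝ) ≤ d i := by
      refine le_trans ?_ (hdbf (d i) (by exact_mod_cast (hpos i hi).2.1))
      simp only [hs_def, Rat.cast_sum]
      calc ∑ j ∈ Icc 1 i, (e j : ℝ) ≤ ∑ j ∈ Icc 1 i, dbf (e j) (d j) (p j) (d i) := by
            refine sum_le_sum fun j hj ↦ ?_
            have hji := (mem_Icc.1 hj).2
            have hjn : j ∈ Icc 1 n := Icc_subset_Icc_right (mem_Icc.1 hi).2 hj
            exact le_dbf (by exact_mod_cast (hpos j hjn).1.le)
              (by exact_mod_cast (hpos j hjn).2.2) (by exact_mod_cast hmono j hjn i hi hji)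
        _ ≤ ∑ j ∈ Icc 1 n, dbf (e j) (d j) (p j) (d i) :=
            sum_le_sum_of_subset_of_nonneg (Icc_subset_Icc_right (mem_Icc.1 hi).2)
              fun j hj _ ↦ dbf_nonneg (by exact_mod_cast (hpos j hj).1.le)
                (by exact_mod_cast (hpos j hj).2.2)
    exact_mod_cast hle
  have hdn : ∀ i ∈ Icc 1 n, d i ≤ d n := fun i hi ↦ hmono i hi n hn_mem (mem_Icc.1 hi).2
  have hsecond : ∀ i ∈ Icc 1 n, d n < d i + p i := by
    intro i hi
    rcases eq_or_ne i n with rfl | hin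
    · linarith [(hpos i hi).2.2]
    · refine hdp i ?_
      simp only [mem_Icc] at hi ⊢
      lia
  refine ⟨e, s, fun i ↦ p i + d i - s i, hs0, ?_, ?_, ?_, ?_, hs, ?_⟩
  · exact fun i hi ↦ ⟨(hpos i hi).1, hs_pos i hi, by linarith [hsd i hi, (hpos i hi).2.2]⟩
  · exact fun i hi ↦ by linarith [hsd i hi, hcd i hi]
  · intro t ht
    push_cast
    rcases lt_or_ge t (d n) with h | h
    · have hone : ∀ i ∈ Icc 1 n, dbf (e i) (s i) (p i + d i - s i) t
          = if t < s i then 0 else (e i : ℝ) := by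
        intro i hi
        have hp : (0 : ℝ) < p i := by exact_mod_cast (hpos i hi).2.2
        have hsd' : (s i : ℝ) ≤ d i := by exact_mod_cast hsd i hi
        have hsecond' : (d n : ℝ) < d i + p i := by exact_mod_cast hsecond i hi
        exact dbf_of_lt_add (by linarith) (by linarith)
      rw [sum_congr rfl hone]
      refine (sum_ite_cumulative_le (s := fun i ↦ (s i : ℝ)) ht.le (by exact_mod_cast hs0) n
        (fun i hi ↦ by exact_mod_cast (hpos i hi).1.le)
        fun i hi ↦ by exact_mod_cast hs i hi).trans (min_le_left _ _)
    · refine (sum_le_sum fun i hi ↦ ?_).trans (hdbf t ht)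
      have hdn' : (d i : ℝ) ≤ d n := by exact_mod_cast hdn i hi
      exact dbf_shorten_deadline_le (by exact_mod_cast (hpos i hi).1.le)
        (by exact_mod_cast (hpos i hi).2.2) (by exact_mod_cast hsd i hi) (hdn'.trans h)
  · intro i hi
    have hi' : i ∈ Icc 1 n := Icc_subset_Icc_right (Nat.sub_le n 1) hi
    linarith [hsecond i hi', hsd n hn_mem]
  · rw [ge_iff_le, sum_div, sum_div]
    refine sum_le_sum fun i hi ↦ ?_
    push_cast
    exact dbfStar_div_le_shorten (by exact_mod_cast (hpos i hi).1.le)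
      (by exact_mod_cast (hpos i hi).2.2) (by exact_mod_cast hcd i hi)
      (by exact_mod_cast hsd i hi) (by exact_mod_cast hdn i hi)
      (by exact_mod_cast (hsecond i hi).le) (by exact_mod_cast hs_mono i hi)
      (by exact_mod_cast hs_pos n hn_mem) (by exact_mod_cast hsd n hn_mem)
end

section
/- Let n be a positive integer, δ a positive rational, and let τ = {τ_i=(δ, i·δ, p_i): 1 ≤ i ≤ n} be tasks with positive rational periods p_i (so e_i = δ, d_i = i·δ, d_n = n·δ) satisfying dbf(τ,t) ≤ t for all t > 0 and d_i + p_i > d_n for all 1 ≤ i ≤ n−1. Let π be a permutation of {1,…,n} such that d_{π(1)} + p_{π(1)} ≤ d_{π(2)} + p_{π(2)} ≤ … ≤ d_{π(n)} + p_{π(n)}. Then d_{π(j)} + p_{π(j)} ≥ d_n + d_j = n·δ + j·δ for every 1 ≤ j ≤ n. -/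
open Finset

/-- Past its deadline a task has demanded at least one job. -/
theorem le_dbf_of_deadline_le {e d p t : ℝ} (he : 0 ≤ e) (hp : 0 < p) (h : d ≤ t) :
    e ≤ dbf e d p t := by
  have hfloor : (0 : ℝ) ≤ (⌊(t - d) / p⌋ : ℝ) := by
    exact_mod_cast Int.floor_nonneg.2 (div_nonneg (sub_nonneg.2 h) hp.le)
  rw [dbf, if_neg h.not_gt]
  nlinarith

/-- Past its second deadline a task has demanded at least two jobs. -/
theorem two_mul_le_dbf_of_add_le {e d p t : ℝ} (he : 0 ≤ e) (hp : 0 < p) (h : d + p ≤ t) :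
    2 * e ≤ dbf e d p t := by
  have hfloor : (1 : ℝ) ≤ (⌊(t - d) / p⌋ : ℝ) := by
    have : (1 : ℤ) ≤ ⌊(t - d) / p⌋ := by
      rw [Int.le_floor, Int.cast_one, one_le_div hp]
      linarith
    exact_mod_cast this
  rw [dbf, if_neg (by linarith)]
  nlinarith

/-- If every task of `s` has passed its deadline at time `t`, and every task of `u ⊆ s` its second
deadline, the total demand is at least `#s + #u` jobs. -/
theorem card_add_card_mul_le_sum_dbf {ι : Type*} {s u : Finset ι} (hu : u ⊆ s) {e t : ℝ}
    (he : 0 ≤ e) {d p : ι → ℝ} (hp : ∀ i ∈ s, 0 < p i) (hd : ∀ i ∈ s, d i ≤ t)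
    (hdp : ∀ i ∈ u, d i + p i ≤ t) :
    ((#s : ℝ) + #u) * e ≤ ∑ i ∈ s, dbf e (d i) (p i) t := by
  classical
  calc ((#s : ℝ) + #u) * e = ∑ i ∈ s, (e + if i ∈ u then e else 0) := by
        rw [Finset.sum_add_distrib, Finset.sum_ite_mem, Finset.inter_eq_right.2 hu]
        simp [add_mul]
    _ ≤ ∑ i ∈ s, dbf e (d i) (p i) t := by
        refine Finset.sum_le_sum fun i hi => ?_
        split_ifs with h
        · linarith [two_mul_le_dbf_of_add_le he (hp i hi) (hdp i h)]
        · linarith [le_dbf_of_deadline_le he (hp i hi) (hd i hi)]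

/-- For tasks `τ_i = (δ, i·δ, p_i)` with positive rational parameters
satisfying `dbf(τ,t) ≤ t` and `d_i + p_i > n·δ` for `i ≤ n−1`, if `π` is a permutation of
`{1,…,n}` sorting the values `d_{π(i)} + p_{π(i)}` nondecreasingly, then
`d_{π(j)} + p_{π(j)} ≥ n·δ + j·δ` for every `1 ≤ j ≤ n`. -/
theorem stmt11 (n : ℕ) (hn : 0 < n) (δ : ℚ) (hδ : 0 < δ)
    (p : ℕ → ℚ) (hp : ∀ i ∈ Finset.Icc 1 n, 0 < p i)
    (hdbf : ∀ t : ℝ, 0 < t →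
      ∑ i ∈ Finset.Icc 1 n, dbf ((δ : ℝ)) ((i : ℝ) * (δ : ℝ)) ((p i : ℝ)) t ≤ t)
    (hdp : ∀ i ∈ Finset.Icc 1 (n - 1), (i : ℚ) * δ + p i > (n : ℚ) * δ)
    (π : Equiv.Perm ℕ) (hπ : ∀ i ∈ Finset.Icc 1 n, π i ∈ Finset.Icc 1 n)
    (hsort : ∀ i ∈ Finset.Icc 1 n, ∀ j ∈ Finset.Icc 1 n, i ≤ j →
      (π i : ℚ) * δ + p (π i) ≤ (π j : ℚ) * δ + p (π j)) :
    ∀ j ∈ Finset.Icc 1 n, (π j : ℚ) * δ + p (π j) ≥ (n : ℚ) * δ + (j : ℚ) * δ := by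
  intro j hj
  obtain ⟨hj1, hjn⟩ := Finset.mem_Icc.1 hj
  by_contra! hlt
  have hnδ : (0 : ℚ) < n * δ := by positivity
  have hjδ : (0 : ℚ) < j * δ := by positivity
  set T : ℚ := max ((π j : ℚ) * δ + p (π j)) (n * δ)
  have hTlt : T < n * δ + j * δ := max_lt hlt (by linarith)
  have hTpos : 0 < T := hnδ.trans_le (le_max_right _ _)
  have hsub : (Finset.Icc 1 j).map π.toEmbedding ⊆ Finset.Icc 1 n := by
    intro i hi
    obtain ⟨k, hk, rfl⟩ := Finset.mem_map.1 hi
    exact hπ k (Finset.Icc_subset_Icc_right hjn hk)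
  have hsum := card_add_card_mul_le_sum_dbf hsub (e := δ) (t := T)
    (d := fun i => (i : ℝ) * δ) (p := fun i => (p i : ℝ)) (by exact_mod_cast hδ.le)
    (fun i hi => by exact_mod_cast hp i hi)
    (fun i hi => by
      have hin : (i : ℚ) ≤ n := by exact_mod_cast (Finset.mem_Icc.1 hi).2
      have : (i : ℚ) * δ ≤ T :=
        (mul_le_mul_of_nonneg_right hin hδ.le).trans (le_max_right _ _)
      exact_mod_cast this)
    (fun i hi => by
      obtain ⟨k, hk, rfl⟩ := Finset.mem_map.1 hi
      have : (π k : ℚ) * δ + p (π k) ≤ T :=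
        (hsort k (Finset.Icc_subset_Icc_right hjn hk) j hj (Finset.mem_Icc.1 hk).2).trans
          (le_max_left _ _)
      exact_mod_cast this)
  have hle := hsum.trans (hdbf T (by exact_mod_cast hTpos))
  simp only [Finset.card_map, Nat.card_Icc, Nat.add_sub_cancel] at hle
  have hle' : ((n : ℚ) + j) * δ ≤ T := by exact_mod_cast hle
  linarith
end
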